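/- For every integer α ≥ 2, the series identity Σ_{k=0}^∞ Γ(2α) Γ(2k+1) Γ(α+k) / (Γ(2α+2k) · k!) = Γ(α−1) Γ(α+1/2) / Γ(α−1/2) holds (each term being nonnegative, the series converges). -/

import Mathlib

open Filter Topology in
/-- A nonnegative sequence with the ratio `(k + 1/2) / (k + a + 1/2)` of consecutive terms, `a ≥ 2`,
sums to `f 0 * (a - 1/2) / (a - 1)` (by telescoping). -/
theorem hasSum_of_hypergeometric_ratio {a : ℝ} (ha : 2 ≤ a) {f : ℕ → ℝ} (hf : ∀ k, 0 ≤ f k)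
    (hrec : ∀ k : ℕ, (2 * a + 2 * k + 1) * f (k + 1) = (2 * k + 1) * f k) :
    HasSum f (f 0 * (a - 1 / 2) / (a - 1)) := by
  have ha1 : a - 1 ≠ 0 := by linarith
  have hpartial : ∀ n : ℕ, ∑ k ∈ Finset.range n, f k =
      f 0 * (a - 1 / 2) / (a - 1) - (2 * n + 2 * a - 1) * f n / (2 * (a - 1)) := by
    intro n
    induction n with
    | zero => simp; field_simp; ring
    | succ n ih =>
      rw [Finset.sum_range_succ, ih]
      have h := hrec n
      push_cast
      field_simp
      linear_combination h
  have hbound : ∀ n : ℕ, (2 * n + 2 * a - 1) * f n * (2 * n + 1) ≤ (2 * a - 1) * f 0 := by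
    intro n
    induction n with
    | zero => simp
    | succ n ih =>
      refine le_trans ?_ ih
      have h := hrec n
      have h0 : (0 : ℝ) ≤ (2 * n + 1) * f n := mul_nonneg (by positivity) (hf n)
      push_cast
      calc (2 * ((n : ℝ) + 1) + 2 * a - 1) * f (n + 1) * (2 * (n + 1) + 1)
          = (2 * n + 1) * f n * (2 * n + 3) := by linear_combination (2 * (n : ℝ) + 3) * h
        _ ≤ (2 * n + 1) * f n * (2 * n + 2 * a - 1) :=
            mul_le_mul_of_nonneg_left (by linarith) h0
        _ = (2 * n + 2 * a - 1) * f n * (2 * n + 1) := by ring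
  have hlim : Tendsto (fun n : ℕ => (2 * n + 2 * a - 1) * f n) atTop (𝓝 0) := by
    have hden : Tendsto (fun n : ℕ => 2 * (n : ℝ) + 1) atTop atTop :=
      tendsto_atTop_add_const_right _ _
        (tendsto_natCast_atTop_atTop.const_mul_atTop (by norm_num))
    refine squeeze_zero (fun n => mul_nonneg ?_ (hf n)) (fun n => ?_)
      (hden.const_div_atTop ((2 * a - 1) * f 0))
    · have : (0 : ℝ) ≤ n := n.cast_nonneg
      linarith
    · rw [le_div_iff₀ (by positivity)]
      exact hbound n
  rw [hasSum_iff_tendsto_nat_of_nonneg hf]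
  simp_rw [hpartial]
  simpa using (hlim.div_const (2 * (a - 1))).const_sub (f 0 * (a - 1 / 2) / (a - 1))

/-- **Gamma-function series identity**: for every integer `α ≥ 2`,
`Σ_{k=0}^∞ Γ(2α) Γ(2k+1) Γ(α+k) / (Γ(2α+2k) k!) = Γ(α−1) Γ(α+1/2) / Γ(α−1/2)`;
each term being nonnegative, the series converges. -/
theorem stmt7 (α : ℕ) (hα : 2 ≤ α) :
    Summable (fun k : ℕ =>
      Real.Gamma (2 * (α : ℝ)) * Real.Gamma (2 * (k : ℝ) + 1) *
        Real.Gamma ((α : ℝ) + (k : ℝ)) /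
        (Real.Gamma (2 * (α : ℝ) + 2 * (k : ℝ)) * (k.factorial : ℝ))) ∧
    (∑' k : ℕ,
      Real.Gamma (2 * (α : ℝ)) * Real.Gamma (2 * (k : ℝ) + 1) *
        Real.Gamma ((α : ℝ) + (k : ℝ)) /
        (Real.Gamma (2 * (α : ℝ) + 2 * (k : ℝ)) * (k.factorial : ℝ))) =
      Real.Gamma ((α : ℝ) - 1) * Real.Gamma ((α : ℝ) + 1 / 2) /
        Real.Gamma ((α : ℝ) - 1 / 2) := by
  have ha : (2 : ℝ) ≤ α := by exact_mod_cast hα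
  have hpos : ∀ k : ℕ, 0 < Real.Gamma (2 * (α : ℝ) + 2 * k) := fun k =>
    Real.Gamma_pos_of_pos (by positivity)
  have key := hasSum_of_hypergeometric_ratio ha (f := fun k : ℕ =>
      Real.Gamma (2 * (α : ℝ)) * Real.Gamma (2 * (k : ℝ) + 1) *
        Real.Gamma ((α : ℝ) + (k : ℝ)) /
        (Real.Gamma (2 * (α : ℝ) + 2 * (k : ℝ)) * (k.factorial : ℝ)))
    (fun k => by
      have h1 := (hpos k).le
      have h2 : 0 ≤ Real.Gamma (2 * (α : ℝ)) := Real.Gamma_nonneg_of_nonneg (by positivity)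
      have h3 : 0 ≤ Real.Gamma (2 * (k : ℝ) + 1) := Real.Gamma_nonneg_of_nonneg (by positivity)
      have h4 : 0 ≤ Real.Gamma ((α : ℝ) + k) := Real.Gamma_nonneg_of_nonneg (by positivity)
      positivity)
    (fun k => by
      have e1 : Real.Gamma (2 * ((k : ℝ) + 1) + 1) =
          (2 * k + 2) * ((2 * k + 1) * Real.Gamma (2 * (k : ℝ) + 1)) := by
        rw [← Real.Gamma_add_one (by positivity : 2 * (k : ℝ) + 1 ≠ 0),
          show 2 * (k : ℝ) + 1 + 1 = 2 * k + 2 by ring,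
          ← Real.Gamma_add_one (by positivity)]
        congr 1; ring
      have e2 : Real.Gamma ((α : ℝ) + (k + 1)) = (α + k) * Real.Gamma ((α : ℝ) + k) := by
        rw [← Real.Gamma_add_one (by positivity), add_assoc]
      have e3 : Real.Gamma (2 * (α : ℝ) + 2 * (k + 1)) =
          (2 * α + 2 * k + 1) * ((2 * α + 2 * k) * Real.Gamma (2 * (α : ℝ) + 2 * k)) := by
        rw [← Real.Gamma_add_one (by positivity : 2 * (α : ℝ) + 2 * k ≠ 0),
          ← Real.Gamma_add_one (by positivity)]
        congr 1; ring
      have hG := (hpos k).ne'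
      have h1 : 2 * (α : ℝ) + 2 * k + 1 ≠ 0 := by positivity
      have h2 : (α : ℝ) + k ≠ 0 := by positivity
      have h3 : (k.factorial : ℝ) ≠ 0 := by positivity
      have h4 : (k : ℝ) + 1 ≠ 0 := by positivity
      have h5 : 2 * (α : ℝ) + 2 * k ≠ 0 := by positivity
      push_cast [Nat.factorial_succ]
      rw [e1, e2, e3]
      field_simp)
  refine ⟨key.summable, key.tsum_eq.trans ?_⟩
  have hG : Real.Gamma (2 * (α : ℝ)) ≠ 0 := (Real.Gamma_pos_of_pos (by linarith)).ne'
  have hH : Real.Gamma ((α : ℝ) - 1 / 2) ≠ 0 := (Real.Gamma_pos_of_pos (by linarith)).ne'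
  have ha1 : (α : ℝ) - 1 ≠ 0 := by linarith
  have g1 : Real.Gamma (α : ℝ) = (α - 1) * Real.Gamma ((α : ℝ) - 1) := by
    rw [← Real.Gamma_add_one ha1, sub_add_cancel]
  have g2 : Real.Gamma ((α : ℝ) + 1 / 2) = (α - 1 / 2) * Real.Gamma ((α : ℝ) - 1 / 2) := by
    rw [← Real.Gamma_add_one (by linarith)]
    congr 1; ring
  simp only [Nat.cast_zero, mul_zero, zero_add, add_zero, Real.Gamma_one, Nat.factorial_zero,
    Nat.cast_one, mul_one]
  rw [g1, g2]
  generalize Real.Gamma ((α : ℝ) - 1 / 2) = H at hH ⊢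
  field_simp
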